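/- arXiv:1806.07756 — 2 statements merged into one kernel-verified Lean document; each statement's English description precedes it below -/
import Mathlib

section
/- Let N, M ≥ 1, let Ω_N ⊆ ℂ^N and Ω_M ⊆ ℂ^M be connected open sets, and let f : Ω_N → Ω_M be a function such that for every pluriharmonic function h : Ω_M → ℝ, the composition h∘f : Ω_N → ℝ is pluriharmonic. Then f is holomorphic or the componentwise complex conjugate z ↦ conj(f(z)) is holomorphic. (Theorem A, implication (2)⇒(3).) -/
/-- A function `h : Ω → ℝ` on an open set `Ω ⊆ ℂ^m` is pluriharmonic if every point of `Ω`
has an open neighborhood `U ⊆ Ω` on which `h` coincides with the real part of a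
holomorphic function. -/
def Pluriharmonic {m : ℕ} (Ω : Set (Fin m → ℂ)) (h : (Fin m → ℂ) → ℝ) : Prop :=
  ∀ w ∈ Ω, ∃ U : Set (Fin m → ℂ), U ⊆ Ω ∧ IsOpen U ∧ w ∈ U ∧
    ∃ g : (Fin m → ℂ) → ℂ, DifferentiableOn ℂ g U ∧ ∀ z ∈ U, h z = (g z).re

open Filter Topology ComplexConjugate

/-- Near `z`, the function `φ` is the sum of a holomorphic and an antiholomorphic function. -/
def IsHolomorphicAddConjAt {E : Type*} [NormedAddCommGroup E] [NormedSpace ℂ E]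
    (φ : E → ℂ) (z : E) : Prop :=
  ∃ a b : E → ℂ, ∀ᶠ w in 𝓝 z,
    DifferentiableAt ℂ a w ∧ DifferentiableAt ℂ b w ∧ φ w = a w + conj (b w)

/-- Comparison of the `∂/∂z̄`-derivatives of the two sides of `a * conj b = p + conj q`. -/
theorem mul_conj_deriv_eq_of_mul_conj_eventuallyEq {a b p q : ℂ → ℂ} {t : ℂ}
    (ha : DifferentiableAt ℂ a t) (hb : DifferentiableAt ℂ b t)
    (hp : DifferentiableAt ℂ p t) (hq : DifferentiableAt ℂ q t)
    (h : (fun s => a s * conj (b s)) =ᶠ[𝓝 t] fun s => p s + conj (q s)) :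
    a t * conj (deriv b t) = conj (deriv q t) := by
  have hd : ∀ s : ℂ, deriv a t * s * conj (b t) + a t * conj (deriv b t * s)
      = deriv p t * s + conj (deriv q t * s) := by
    intro s
    have hline : HasDerivAt (fun r : ℝ => t + (r : ℂ) * s) s 0 := by
      simpa using ((Complex.ofRealCLM.hasDerivAt (x := 0)).mul_const s).const_add t
    have key : ∀ {g : ℂ → ℂ}, DifferentiableAt ℂ g t →
        HasDerivAt (fun r : ℝ => g (t + (r : ℂ) * s)) (deriv g t * s) 0 := by
      intro g hg
      have hg' : HasDerivAt g (deriv g t) (t + ((0 : ℝ) : ℂ) * s) := by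
        simpa using hg.hasDerivAt
      simpa [Function.comp_def, mul_comm] using hg'.scomp (0 : ℝ) hline
    have hl := (key ha).mul (key hb).star
    have hr := (key hp).add (key hq).star
    have hcont : Tendsto (fun r : ℝ => t + (r : ℂ) * s) (𝓝 0) (𝓝 t) := by
      simpa using hline.continuousAt.tendsto
    have heq := hl.unique (hr.congr_of_eventuallyEq (hcont.eventually h))
    simpa using heq
  have h1 := hd 1
  have hI := hd Complex.I
  simp only [map_mul, Complex.conj_I, mul_one] at h1 hI
  have hfac : 2 * Complex.I * (a t * conj (deriv b t) - conj (deriv q t)) = 0 := by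
    linear_combination Complex.I * h1 - hI
  exact sub_eq_zero.1 ((mul_eq_zero.1 hfac).resolve_left (by simp))

theorem deriv_mul_deriv_eq_zero_of_sq {a b : ℂ → ℂ} {t : ℂ}
    (ha : ∀ᶠ s in 𝓝 t, DifferentiableAt ℂ a s) (hb : ∀ᶠ s in 𝓝 t, DifferentiableAt ℂ b s)
    (h : IsHolomorphicAddConjAt (fun s => (a s + conj (b s)) ^ 2) t) :
    deriv a t * deriv b t = 0 := by
  obtain ⟨c, d, hcd⟩ := h
  have hprod : ∀ᶠ s in 𝓝 t, 2 * a s * conj (b s)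
      = (c s - a s ^ 2) + conj (d s - b s ^ 2) := by
    filter_upwards [hcd] with s hs
    have := hs.2.2
    simp only [map_sub, map_pow]
    linear_combination this
  have hfirst : ∀ᶠ s in 𝓝 t,
      2 * deriv b s * conj (a s) = deriv (fun s => d s - b s ^ 2) s + conj 0 := by
    filter_upwards [ha, hb, hcd, hprod.eventually_nhds] with s has hbs hs hps
    have := mul_conj_deriv_eq_of_mul_conj_eventuallyEq (has.const_mul 2) hbs
      (hs.1.sub (has.pow 2)) (hs.2.1.sub (hbs.pow 2)) hps
    have := congrArg conj this
    simp only [map_mul, Complex.conj_conj, Complex.conj_ofNat] at this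
    rw [map_zero, add_zero]
    refine Eq.trans ?_ this
    ring
  have hderiv : ∀ {g : ℂ → ℂ}, (∀ᶠ s in 𝓝 t, DifferentiableAt ℂ g s) →
      DifferentiableAt ℂ (deriv g) t := fun hg =>
    (Complex.analyticAt_iff_eventually_differentiableAt.2 hg).deriv.differentiableAt
  have hq : ∀ᶠ s in 𝓝 t, DifferentiableAt ℂ (fun s => d s - b s ^ 2) s := by
    filter_upwards [hb, hcd] with s hbs hs using hs.2.1.sub (hbs.pow 2)
  have := mul_conj_deriv_eq_of_mul_conj_eventuallyEq ((hderiv hb).const_mul 2)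
    ha.self_of_nhds (hderiv hq) (differentiableAt_const (0 : ℂ)) hfirst
  simp only [deriv_const, map_zero, mul_eq_zero, map_eq_zero] at this
  rcases this with (h2 | h2) | h2
  · norm_num at h2
  · simp [h2]
  · simp [h2]

section Slices

variable {E : Type*} [NormedAddCommGroup E] [NormedSpace ℂ E]

theorem differentiable_complex_lineMap (p q : E) :
    Differentiable ℂ (fun t : ℂ => AffineMap.lineMap (k := ℂ) p q t) := by
  simp only [AffineMap.lineMap_apply_module']
  fun_prop

theorem Convex.isPreconnected_preimage_complex_lineMap {S : Set E} (hS : Convex ℝ S) (p q : E) :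
    IsPreconnected ((fun t : ℂ => AffineMap.lineMap (k := ℂ) p q t) ⁻¹' S) := by
  refine Convex.isPreconnected fun s hs t ht α β hα hβ hαβ => ?_
  have hmem := hS hs ht hα hβ hαβ
  rw [Set.mem_preimage]
  convert hmem using 1
  obtain rfl : β = 1 - α := by linarith
  simp only [AffineMap.lineMap_apply_module', Complex.ofReal_sub,
    Complex.ofReal_one, ← Complex.coe_smul]
  module

/-- Identity theorem for holomorphic functions of several variables on a convex open set, in the
case of a constant. -/
theorem DifferentiableOn.eqOn_const_of_convex {F : Type*} [NormedAddCommGroup F]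
    [NormedSpace ℂ F] [CompleteSpace F] {S : Set E} (hS : Convex ℝ S) (hSo : IsOpen S)
    {g : E → F} (hg : DifferentiableOn ℂ g S) {p : E} (hp : p ∈ S) {c : F}
    (hc : ∀ᶠ w in 𝓝 p, g w = c) : ∀ z ∈ S, g z = c := by
  intro z hz
  have hl := differentiable_complex_lineMap p z
  have hd := hg.comp hl.differentiableOn (Set.mapsTo_preimage _ S)
  have hUo := hSo.preimage hl.continuous
  have h0 : Tendsto (fun t : ℂ => AffineMap.lineMap (k := ℂ) p z t) (𝓝 0) (𝓝 p) := by
    simpa using hl.continuous.tendsto 0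
  have := (hd.analyticOnNhd hUo).eqOn_of_preconnected_of_eventuallyEq
    (analyticOnNhd_const (v := c)) (hS.isPreconnected_preimage_complex_lineMap p z)
    (z₀ := 0) (by simpa using hp) (h0.eventually hc) (x := 1) (by simpa using hz)
  simpa using this

theorem IsHolomorphicAddConjAt.comp {φ : E → ℂ} {l : ℂ → E} (hl : Differentiable ℂ l) {t : ℂ}
    (h : IsHolomorphicAddConjAt φ (l t)) : IsHolomorphicAddConjAt (fun s => φ (l s)) t := by
  obtain ⟨a, b, hab⟩ := h
  refine ⟨a ∘ l, b ∘ l, ?_⟩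
  filter_upwards [hl.continuous.continuousAt.eventually hab] with s hs
  exact ⟨hs.1.comp s (hl s), hs.2.1.comp s (hl s), hs.2.2⟩

theorem const_or_const_of_sq {S : Set E} (hS : Convex ℝ S) (hSo : IsOpen S) {a b : E → ℂ}
    (ha : DifferentiableOn ℂ a S) (hb : DifferentiableOn ℂ b S)
    (h : ∀ z ∈ S, IsHolomorphicAddConjAt (fun w => (a w + conj (b w)) ^ 2) z)
    {p : E} (hp : p ∈ S) : (∀ z ∈ S, a z = a p) ∨ (∀ z ∈ S, b z = b p) := by
  have hpt : ∀ z ∈ S, a z = a p ∨ b z = b p := by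
    intro z hz
    have hl := differentiable_complex_lineMap p z
    have hUo := hSo.preimage hl.continuous
    have hUc := hS.isPreconnected_preimage_complex_lineMap p z
    have hda := ha.comp hl.differentiableOn (Set.mapsTo_preimage _ S)
    have hdb := hb.comp hl.differentiableOn (Set.mapsTo_preimage _ S)
    have hz1 : (1 : ℂ) ∈ (fun t : ℂ => AffineMap.lineMap (k := ℂ) p z t) ⁻¹' S := by
      simpa using hz
    have hp0 : (0 : ℂ) ∈ (fun t : ℂ => AffineMap.lineMap (k := ℂ) p z t) ⁻¹' S := by
      simpa using hp
    have hzero := (hda.analyticOnNhd hUo).deriv.eq_zero_or_eq_zero_of_mul_eq_zero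
      (hdb.analyticOnNhd hUo).deriv (fun t ht => deriv_mul_deriv_eq_zero_of_sq
        (hda.eventually_differentiableAt (hUo.mem_nhds ht))
        (hdb.eventually_differentiableAt (hUo.mem_nhds ht)) ((h _ ht).comp hl)) hUc
    refine hzero.imp (fun h0 => ?_) fun h0 => ?_
    · simpa using hUo.is_const_of_deriv_eq_zero hUc hda h0 hz1 hp0
    · simpa using hUo.is_const_of_deriv_eq_zero hUc hdb h0 hz1 hp0
  refine or_iff_not_imp_left.2 fun hne => ?_
  push Not at hne
  obtain ⟨z, hz, hzp⟩ := hne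
  refine hb.eqOn_const_of_convex hS hSo hz ?_
  filter_upwards [(ha.continuousOn.continuousAt (hSo.mem_nhds hz)).eventually_ne hzp,
    hSo.mem_nhds hz] with w hw hwS
  exact (hpt w hwS).resolve_left hw

theorem eq_const_of_differentiableOn_conj {S : Set E} (hS : Convex ℝ S) (hSo : IsOpen S)
    {g : E → ℂ} (hg : DifferentiableOn ℂ g S)
    (hg' : DifferentiableOn ℂ (fun z => conj (g z)) S) {p : E} (hp : p ∈ S) :
    ∀ z ∈ S, g z = g p := by
  have := const_or_const_of_sq hS hSo hg hg' (fun z hz => ⟨fun w => (g w + g w) ^ 2, 0, by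
    filter_upwards [hg.eventually_differentiableAt (hSo.mem_nhds hz)] with w hw
    exact ⟨(hw.add hw).pow 2, differentiableAt_const _, by simp⟩⟩) hp
  rcases this with h | h
  · exact h
  · exact fun z hz => star_injective (h z hz)

end Slices

theorem Pluriharmonic.of_re {m : ℕ} {Ω : Set (Fin m → ℂ)} (hΩ : IsOpen Ω)
    {g : (Fin m → ℂ) → ℂ} (hg : DifferentiableOn ℂ g Ω) :
    Pluriharmonic Ω fun z => (g z).re :=
  fun _ hw => ⟨Ω, subset_rfl, hΩ, hw, g, hg, fun _ _ => rfl⟩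

theorem Pluriharmonic.of_im {m : ℕ} {Ω : Set (Fin m → ℂ)} (hΩ : IsOpen Ω)
    {g : (Fin m → ℂ) → ℂ} (hg : DifferentiableOn ℂ g Ω) :
    Pluriharmonic Ω fun z => (g z).im := by
  simpa using Pluriharmonic.of_re hΩ (hg.const_mul (-Complex.I))

theorem isHolomorphicAddConjAt_of_pluriharmonic {m : ℕ} {Ω : Set (Fin m → ℂ)}
    {φ : (Fin m → ℂ) → ℂ} (hre : Pluriharmonic Ω fun z => (φ z).re)
    (him : Pluriharmonic Ω fun z => (φ z).im) {z : Fin m → ℂ} (hz : z ∈ Ω) :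
    IsHolomorphicAddConjAt φ z := by
  obtain ⟨U, -, hU, hzU, g, hg, hgφ⟩ := hre z hz
  obtain ⟨V, -, hV, hzV, k, hk, hkφ⟩ := him z hz
  refine ⟨fun w => (g w + Complex.I * k w) / 2, fun w => (g w - Complex.I * k w) / 2, ?_⟩
  filter_upwards [hU.mem_nhds hzU, hV.mem_nhds hzV] with w hwU hwV
  have hgw := hg.differentiableAt (hU.mem_nhds hwU)
  have hkw := hk.differentiableAt (hV.mem_nhds hwV)
  refine ⟨by fun_prop, by fun_prop, ?_⟩
  have h1 := hgφ w hwU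
  have h2 := hkφ w hwV
  apply Complex.ext <;> simp [h1, h2, Complex.conj_ofNat] <;> ring

section PreservesPluriharmonic

variable {N M : ℕ} {ΩN : Set (Fin N → ℂ)} {ΩM : Set (Fin M → ℂ)}
  {f : (Fin N → ℂ) → (Fin M → ℂ)}

theorem isHolomorphicAddConjAt_comp (hΩM : IsOpen ΩM)
    (hcomp : ∀ h : (Fin M → ℂ) → ℝ, Pluriharmonic ΩM h → Pluriharmonic ΩN (h ∘ f))
    {g : (Fin M → ℂ) → ℂ} (hg : DifferentiableOn ℂ g ΩM) {z : Fin N → ℂ} (hz : z ∈ ΩN) :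
    IsHolomorphicAddConjAt (fun w => g (f w)) z :=
  isHolomorphicAddConjAt_of_pluriharmonic (hcomp _ (.of_re hΩM hg)) (hcomp _ (.of_im hΩM hg)) hz

theorem exists_ball_differentiableOn_or_conj (hΩN : IsOpen ΩN) (hΩM : IsOpen ΩM)
    (hcomp : ∀ h : (Fin M → ℂ) → ℝ, Pluriharmonic ΩM h → Pluriharmonic ΩN (h ∘ f))
    {z : Fin N → ℂ} (hz : z ∈ ΩN) :
    ∃ r > 0, DifferentiableOn ℂ f (Metric.ball z r) ∨
      DifferentiableOn ℂ (fun w j => conj (f w j)) (Metric.ball z r) := by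
  have hcoord : ∀ j, IsHolomorphicAddConjAt (fun w => f w j) z := fun j =>
    isHolomorphicAddConjAt_comp hΩM hcomp (g := fun w => w j) (by fun_prop) hz
  choose a b hab using hcoord
  obtain ⟨r, hr, hball⟩ := Metric.eventually_nhds_iff_ball.1
    ((eventually_all.2 hab).and (hΩN.mem_nhds hz))
  have hda : ∀ j, DifferentiableOn ℂ (a j) (Metric.ball z r) := fun j w hw =>
    ((hball w hw).1 j).1.differentiableWithinAt
  have hdb : ∀ j, DifferentiableOn ℂ (b j) (Metric.ball z r) := fun j w hw =>
    ((hball w hw).1 j).2.1.differentiableWithinAt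
  have hf : ∀ j, ∀ w ∈ Metric.ball z r, f w j = a j w + conj (b j w) := fun j w hw =>
    ((hball w hw).1 j).2.2
  have hzr := Metric.mem_ball_self (x := z) hr
  have hsum : ∀ j k, (∀ w ∈ Metric.ball z r, a j w + a k w = a j z + a k z) ∨
      (∀ w ∈ Metric.ball z r, b j w + b k w = b j z + b k z) := by
    intro j k
    refine const_or_const_of_sq (convex_ball z r) Metric.isOpen_ball ((hda j).add (hda k))
      ((hdb j).add (hdb k)) (fun w hw => ?_) hzr
    obtain ⟨c, d, hcd⟩ := isHolomorphicAddConjAt_comp hΩM hcomp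
      (g := fun w => (w j + w k) ^ 2) (by fun_prop) (hball w hw).2
    refine ⟨c, d, ?_⟩
    filter_upwards [hcd, Metric.isOpen_ball.mem_nhds hw] with x hx hxr
    refine ⟨hx.1, hx.2.1, ?_⟩
    rw [← hx.2.2, hf j x hxr, hf k x hxr]
    simp only [Pi.add_apply, map_add]
    ring
  have hself : ∀ j, (∀ w ∈ Metric.ball z r, a j w = a j z) ∨
      (∀ w ∈ Metric.ball z r, b j w = b j z) := fun j =>
    (hsum j j).imp (fun h w hw => by linear_combination (1 / 2) * h w hw)
      fun h w hw => by linear_combination (1 / 2) * h w hw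
  have hall : (∀ j, ∀ w ∈ Metric.ball z r, a j w = a j z) ∨
      (∀ j, ∀ w ∈ Metric.ball z r, b j w = b j z) := by
    by_contra hne
    rw [not_or, not_forall, not_forall] at hne
    obtain ⟨⟨j, hj⟩, k, hk⟩ := hne
    have hbj := (hself j).resolve_left hj
    have hak := (hself k).resolve_right hk
    rcases hsum j k with h | h
    · exact hj fun w hw => by linear_combination h w hw - hak w hw
    · exact hk fun w hw => by linear_combination h w hw - hbj w hw
  refine ⟨r, hr, hall.symm.imp (fun h => ?_) fun h => ?_⟩
  · refine differentiableOn_pi.2 fun j => ((hda j).add_const (conj (b j z))).congr fun w hw => ?_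
    rw [hf j w hw, h j w hw]
  · refine differentiableOn_pi.2 fun j => ((hdb j).const_add (conj (a j z))).congr fun w hw => ?_
    simp [hf j w hw, h j w hw]

end PreservesPluriharmonic

/-- A map on a connected open set which is locally holomorphic or antiholomorphic is globally
holomorphic or antiholomorphic. -/
theorem differentiableOn_or_conj_of_locally {E : Type*} [NormedAddCommGroup E] [NormedSpace ℂ E]
    {M : ℕ} {Ω : Set E} (hΩc : IsPreconnected Ω) {f : E → (Fin M → ℂ)}
    (h : ∀ z ∈ Ω, ∃ r > 0, DifferentiableOn ℂ f (Metric.ball z r) ∨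
      DifferentiableOn ℂ (fun w j => conj (f w j)) (Metric.ball z r)) :
    DifferentiableOn ℂ f Ω ∨ DifferentiableOn ℂ (fun z j => conj (f z j)) Ω := by
  let A : Set E := {z | ∀ᶠ w in 𝓝 z, DifferentiableAt ℂ f w}
  let B : Set E := {z | ∀ᶠ w in 𝓝 z, DifferentiableAt ℂ (fun w j => conj (f w j)) w}
  have hcover : Ω ⊆ A ∪ B := fun z hz => by
    obtain ⟨r, hr, hd⟩ := h z hz
    exact hd.imp (fun hd => hd.eventually_differentiableAt (Metric.ball_mem_nhds z hr))
      fun hd => hd.eventually_differentiableAt (Metric.ball_mem_nhds z hr)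
  by_cases hAB : Ω ∩ (A ∩ B) = ∅
  · refine (isPreconnected_iff_subset_of_disjoint.1 hΩc A B isOpen_setOfPred_eventually_nhds
      isOpen_setOfPred_eventually_nhds hcover hAB).imp ?_ ?_ <;>
    exact fun hs z hz => (hs hz).self_of_nhds.differentiableWithinAt
  obtain ⟨p, hpΩ, hpA, hpB⟩ := Set.nonempty_iff_ne_empty.2 hAB
  left
  let C : Set E := {z | ∀ᶠ w in 𝓝 z, f w = f p}
  have hpC : p ∈ C := by
    obtain ⟨r, hr, hball⟩ := Metric.eventually_nhds_iff_ball.1 (hpA.and hpB)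
    filter_upwards [Metric.ball_mem_nhds p hr] with w hw
    funext j
    exact eq_const_of_differentiableOn_conj (convex_ball p r) Metric.isOpen_ball
      (g := fun w => f w j)
      (fun x hx => (differentiableAt_pi.1 (hball x hx).1 j).differentiableWithinAt)
      (fun x hx => (differentiableAt_pi.1 (hball x hx).2 j).differentiableWithinAt)
      (Metric.mem_ball_self hr) w hw
  have hΩC : Ω ⊆ C := by
    refine hΩc.subset_of_closure_inter_subset isOpen_setOfPred_eventually_nhds ⟨p, hpΩ, hpC⟩ ?_
    rintro z ⟨hzC, hzΩ⟩
    obtain ⟨r, hr, hd⟩ := h z hzΩ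
    obtain ⟨q, hqC, hqz⟩ := Metric.mem_closure_iff.1 hzC r hr
    have hq : q ∈ Metric.ball z r := by rwa [Metric.mem_ball, dist_comm]
    filter_upwards [Metric.ball_mem_nhds z hr] with w hw
    rcases hd with hd | hd
    · exact hd.eqOn_const_of_convex (convex_ball z r) Metric.isOpen_ball hq hqC w hw
    · have := hd.eqOn_const_of_convex (convex_ball z r) Metric.isOpen_ball hq
        (hqC.mono fun x hx => by rw [hx]) w hw
      exact funext fun j => star_injective (congrFun this j)
  intro z hz
  exact ((differentiableAt_const (f p)).congr_of_eventuallyEq (hΩC hz)).differentiableWithinAt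

/-- Theorem A, implication (2) ⇒ (3): if composition with `f` preserves
pluriharmonicity, then `f` is holomorphic or its componentwise conjugate is holomorphic. -/
theorem theoremA_2_implies_3 (N M : ℕ) (hN : 1 ≤ N) (hM : 1 ≤ M)
    (ΩN : Set (Fin N → ℂ)) (ΩM : Set (Fin M → ℂ))
    (hΩN : IsOpen ΩN) (hΩM : IsOpen ΩM)
    (hcN : IsConnected ΩN) (hcM : IsConnected ΩM)
    (f : (Fin N → ℂ) → (Fin M → ℂ)) (hmaps : Set.MapsTo f ΩN ΩM)
    (hcomp : ∀ h : (Fin M → ℂ) → ℝ, Pluriharmonic ΩM h → Pluriharmonic ΩN (h ∘ f)) :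
    DifferentiableOn ℂ f ΩN ∨
      DifferentiableOn ℂ (fun z j => (starRingEnd ℂ) (f z j)) ΩN :=
  differentiableOn_or_conj_of_locally hcN.isPreconnected fun _ hz =>
    exists_ball_differentiableOn_or_conj hΩN hΩM hcomp hz
end

section
/- For all integers 1 ≤ k ≤ N, the set Λ_{k,N} ⊆ ℝ^N is a closed convex cone: it is closed, convex, and satisfies t·x ∈ Λ_{k,N} for every x ∈ Λ_{k,N} and every real t ≥ 0. (Proposition 3.6(2).) -/
/-- The `l`-th elementary symmetric polynomial of `x ∈ ℝ^N`. -/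
def esymm {N : ℕ} (l : ℕ) (x : Fin N → ℝ) : ℝ :=
  ∑ s ∈ Finset.powersetCard l (Finset.univ : Finset (Fin N)), ∏ j ∈ s, x j

/-- The cone `Λ_{k,N} = {x ∈ ℝ^N : σ_l(x) ≥ 0, l = 1,…,k}`. -/
def Lambda (k N : ℕ) : Set (Fin N → ℝ) :=
  {x | ∀ l, 1 ≤ l → l ≤ k → 0 ≤ esymm l x}

/-- The `l`-th elementary symmetric polynomial in the variables `x i`, `i ∈ s`. -/
noncomputable def esymmOn {ι : Type*} (l : ℕ) (s : Finset ι) (x : ι → ℝ) : ℝ :=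
  ∑ u ∈ Finset.powersetCard l s, ∏ j ∈ u, x j

namespace esymmOn

variable {ι : Type*}

@[simp]
theorem zero_left (s : Finset ι) (x : ι → ℝ) : esymmOn 0 s x = 1 := by
  simp [esymmOn]

@[simp]
theorem succ_empty (l : ℕ) (x : ι → ℝ) : esymmOn (l + 1) ∅ x = 0 := by
  rw [esymmOn, Finset.powersetCard_eq_empty.2 (by simp), Finset.sum_empty]

theorem one_left (s : Finset ι) (x : ι → ℝ) : esymmOn 1 s x = ∑ i ∈ s, x i := by
  simp [esymmOn, Finset.powersetCard_one]

theorem continuous (l : ℕ) (s : Finset ι) : Continuous (esymmOn l s) := by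
  unfold esymmOn
  fun_prop

theorem smul (l : ℕ) (s : Finset ι) (t : ℝ) (x : ι → ℝ) :
    esymmOn l s (t • x) = t ^ l * esymmOn l s x := by
  rw [esymmOn, esymmOn, Finset.mul_sum]
  refine Finset.sum_congr rfl fun u hu => ?_
  simp [Finset.prod_mul_distrib, (Finset.mem_powersetCard.1 hu).2]

variable [DecidableEq ι]

theorem succ_insert (l : ℕ) {s : Finset ι} {i : ι} (hi : i ∉ s) (x : ι → ℝ) :
    esymmOn (l + 1) (insert i s) x = esymmOn (l + 1) s x + x i * esymmOn l s x := by
  have hmem : ∀ u ∈ Finset.powersetCard l s, i ∉ u := fun u hu h =>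
    hi ((Finset.mem_powersetCard.1 hu).1 h)
  rw [esymmOn, Finset.powersetCard_succ_insert hi, Finset.sum_union, Finset.sum_image]
  · simp only [esymmOn, Finset.mul_sum]
    congr 1
    exact Finset.sum_congr rfl fun u hu => Finset.prod_insert (hmem u hu)
  · intro u hu v hv huv
    rw [← Finset.erase_insert (hmem u hu), ← Finset.erase_insert (hmem v hv), huv]
  · rw [Finset.disjoint_left]
    rintro u hu hu'
    obtain ⟨v, -, rfl⟩ := Finset.mem_image.1 hu'
    exact hi ((Finset.mem_powersetCard.1 hu).1 (Finset.mem_insert_self i v))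

theorem succ_eq_erase (l : ℕ) {s : Finset ι} {i : ι} (hi : i ∈ s) (x : ι → ℝ) :
    esymmOn (l + 1) s x =
      esymmOn (l + 1) (s.erase i) x + x i * esymmOn l (s.erase i) x := by
  rw [← succ_insert l (Finset.notMem_erase i s), Finset.insert_erase hi]

/-- Euler's identity for the elementary symmetric polynomials. -/
theorem sum_mul_erase (l : ℕ) (s : Finset ι) (x : ι → ℝ) :
    ∑ i ∈ s, x i * esymmOn l (s.erase i) x = (l + 1) * esymmOn (l + 1) s x := by
  induction s using Finset.induction_on generalizing l with
  | empty => simp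
  | insert a s ha ih =>
    rw [Finset.sum_insert ha, Finset.erase_insert ha]
    cases l with
    | zero => simp [one_left, Finset.sum_insert ha]
    | succ l =>
      have h : ∀ i ∈ s, x i * esymmOn (l + 1) ((insert a s).erase i) x =
          x i * esymmOn (l + 1) (s.erase i) x + x a * (x i * esymmOn l (s.erase i) x) := by
        intro i hi
        have hai : a ≠ i := fun h => ha (h ▸ hi)
        rw [Finset.erase_insert_of_ne hai,
          succ_insert l (fun h => ha (Finset.mem_of_mem_erase h))]
        ring
      rw [Finset.sum_congr rfl h, Finset.sum_add_distrib, ← Finset.mul_sum, ih, ih,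
        succ_insert (l + 1) ha]
      push_cast
      ring

theorem coeff_prod (l : ℕ) (s : Finset ι) (x : ι → ℝ) :
    (∏ i ∈ s, (1 + Polynomial.C (x i) * Polynomial.X)).coeff l = esymmOn l s x := by
  induction s using Finset.induction_on generalizing l with
  | empty => cases l <;> simp [Polynomial.coeff_one]
  | insert a s ha ih =>
    rw [Finset.prod_insert ha, add_mul, one_mul, mul_assoc, Polynomial.coeff_add,
      Polynomial.coeff_C_mul]
    cases l with
    | zero => simp [ih]
    | succ l => rw [Polynomial.coeff_X_mul, ih, ih, succ_insert l ha]

theorem hasDerivAt_add_const (l : ℕ) (s : Finset ι) (x : ι → ℝ) (t : ℝ) :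
    HasDerivAt (fun t : ℝ => esymmOn (l + 1) s (fun i => x i + t))
      (((s.card : ℝ) - l) * esymmOn l s (fun i => x i + t)) t := by
  induction s using Finset.induction_on generalizing l with
  | empty =>
    cases l with
    | zero => simpa using hasDerivAt_const t (0 : ℝ)
    | succ l => simpa using hasDerivAt_const t (0 : ℝ)
  | insert a s ha ih =>
    simp only [succ_insert _ ha, Finset.card_insert_of_notMem ha]
    have hlin : HasDerivAt (fun t : ℝ => x a + t) 1 t := (hasDerivAt_id t).const_add _
    cases l with
    | zero =>
      simp only [zero_left, mul_one]
      refine ((ih 0).add hlin).congr_deriv ?_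
      simp
    | succ l =>
      refine ((ih (l + 1)).add (hlin.mul (ih l))).congr_deriv ?_
      rw [succ_insert _ ha]
      push_cast
      ring

end esymmOn

namespace Polynomial

/-- The derivative of a real-rooted polynomial is real-rooted. -/
theorem Splits.derivative_real {p : ℝ[X]} (hp : p.Splits) : p.derivative.Splits := by
  rw [splits_iff_card_roots] at hp ⊢
  have h1 := card_roots_le_derivative p
  have h2 := card_roots' p.derivative
  have h3 := natDegree_derivative_le p
  by_cases h0 : p.natDegree = 0
  · rw [derivative_of_natDegree_zero h0]
    simp
  · omega

theorem Splits.iterate_derivative_real {p : ℝ[X]} (hp : p.Splits) (n : ℕ) :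
    (derivative^[n] p).Splits := by
  induction n with
  | zero => exact hp
  | succ n ih =>
    rw [Function.iterate_succ_apply']
    exact ih.derivative_real

/-- **Laguerre's inequality** for real-rooted polynomials. -/
theorem Splits.laguerre {p : ℝ[X]} (hp : p.Splits) (t : ℝ) :
    p.eval t * (derivative (derivative p)).eval t ≤ (derivative p).eval t ^ 2 := by
  have key : ∀ (c : ℝ) (m : Multiset ℝ) (q : ℝ[X]),
      q = C c * (m.map fun r => X - C r).prod →
      q.eval t * (derivative (derivative q)).eval t ≤ (derivative q).eval t ^ 2 := by
    intro c m
    induction m using Multiset.induction_on with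
    | empty => rintro q rfl; simp
    | cons r m ih =>
      rintro q rfl
      have h := ih _ rfl
      set f := C c * (m.map fun r => X - C r).prod with hf
      have hq : C c * ((r ::ₘ m).map fun r => X - C r).prod = (X - C r) * f := by
        rw [hf, Multiset.map_cons, Multiset.prod_cons]; ring
      rw [hq]
      simp only [derivative_mul, derivative_sub, derivative_X, derivative_C, sub_zero, one_mul,
        derivative_add, eval_add, eval_mul, eval_sub, eval_X, eval_C]
      nlinarith [sq_nonneg (f.eval t), mul_le_mul_of_nonneg_left h (sq_nonneg (t - r))]
  exact key _ _ p hp.eq_prod_roots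

end Polynomial

namespace esymmOn

variable {ι : Type*} [DecidableEq ι]

/-- A weak form of **Newton's inequality**. -/
theorem mul_le_sq (l : ℕ) (s : Finset ι) (x : ι → ℝ) :
    esymmOn l s x * esymmOn (l + 2) s x ≤ esymmOn (l + 1) s x ^ 2 := by
  set p : Polynomial ℝ := ∏ i ∈ s, (1 + Polynomial.C (x i) * Polynomial.X) with hp
  have hsplit : p.Splits := by
    refine Polynomial.Splits.prod fun i _ => Polynomial.Splits.of_natDegree_le_one ?_
    rw [add_comm, ← Polynomial.C_1]
    exact Polynomial.natDegree_linear_le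
  have h := (hsplit.iterate_derivative_real l).laguerre 0
  rw [← Function.iterate_succ_apply' Polynomial.derivative,
    ← Function.iterate_succ_apply' Polynomial.derivative] at h
  have hev : ∀ m, (Polynomial.derivative^[m] p).eval 0 = m.factorial * esymmOn m s x := by
    intro m
    rw [← Polynomial.coeff_zero_eq_eval_zero, Polynomial.coeff_iterate_derivative, hp,
      coeff_prod]
    simp [Nat.descFactorial_self]
  rw [hev, hev, hev, Nat.factorial_succ (l + 1), Nat.factorial_succ l] at h
  push_cast at h
  have hf : (0 : ℝ) < l.factorial := by exact_mod_cast l.factorial_pos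
  set a := esymmOn l s x
  set b := esymmOn (l + 1) s x
  set c := esymmOn (l + 2) s x
  have h' : ((l : ℝ) + 2) * (a * c) ≤ (l + 1) * b ^ 2 := by
    have hpos : (0 : ℝ) < (l.factorial : ℝ) ^ 2 * (l + 1) := by positivity
    refine le_of_mul_le_mul_left ?_ hpos
    linarith
  have hl : (0 : ℝ) ≤ l := l.cast_nonneg
  nlinarith [sq_nonneg b]

/-- The open Gårding cone is mapped to the next lower one by deleting a variable. -/
theorem erase_pos {k : ℕ} {s : Finset ι} {x : ι → ℝ}
    (hx : ∀ l ≤ k + 1, 0 < esymmOn l s x) {i : ι} (hi : i ∈ s) :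
    ∀ l ≤ k, 0 < esymmOn l (s.erase i) x := by
  intro l
  induction l with
  | zero => simp
  | succ l ih =>
    intro hl
    have h0 := ih (by omega)
    have h1 := hx (l + 1) (by omega)
    have h2 := hx (l + 2) (by omega)
    rw [succ_eq_erase _ hi] at h1 h2
    have hN := mul_le_sq l (s.erase i) x
    by_contra! hneg
    nlinarith [mul_pos h0 h2, mul_nonneg (neg_nonneg.2 hneg) h1.le]

theorem mul_erase_div {k : ℕ} {s : Finset ι} {x : ι → ℝ}
    (hx : 0 < esymmOn (k + 1) s x) {i : ι} (hi : i ∈ s)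
    (hxi : 0 < esymmOn k (s.erase i) x) :
    x i * esymmOn (k + 1) (s.erase i) x / esymmOn (k + 1) s x =
      x i - x i ^ 2 / (x i + esymmOn (k + 1) (s.erase i) x / esymmOn k (s.erase i) x) := by
  have h := succ_eq_erase k hi x
  have hw : x i + esymmOn (k + 1) (s.erase i) x / esymmOn k (s.erase i) x =
      esymmOn (k + 1) s x / esymmOn k (s.erase i) x := by
    rw [h]
    field_simp
    ring
  rw [hw]
  field_simp
  rw [h]
  ring

theorem add_sq_div_le {a b u v w : ℝ} (hu : 0 < u) (hv : 0 < v) (hw : u + v ≤ w) :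
    (a + b) ^ 2 / w ≤ a ^ 2 / u + b ^ 2 / v := by
  calc (a + b) ^ 2 / w ≤ (a + b) ^ 2 / (u + v) := by gcongr
    _ ≤ a ^ 2 / u + b ^ 2 / v := by
      rw [div_add_div _ _ hu.ne' hv.ne', div_le_div_iff₀ (by positivity) (by positivity)]
      nlinarith [sq_nonneg (a * v - b * u)]

/-- The open Gårding cone is closed under addition, and on it the quotient of consecutive
elementary symmetric polynomials is superadditive (Marcus–Lopes). -/
theorem add_pos_and_superadditive (k : ℕ) (s : Finset ι) (x y : ι → ℝ)
    (hx : ∀ l ≤ k, 0 < esymmOn l s x) (hy : ∀ l ≤ k, 0 < esymmOn l s y) :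
    (∀ l ≤ k, 0 < esymmOn l s (x + y)) ∧
      esymmOn (k + 1) s x / esymmOn k s x + esymmOn (k + 1) s y / esymmOn k s y ≤
        esymmOn (k + 1) s (x + y) / esymmOn k s (x + y) := by
  induction k generalizing s with
  | zero =>
    refine ⟨fun l hl => ?_, ?_⟩
    · obtain rfl : l = 0 := by omega
      simp
    · simp [one_left, Finset.sum_add_distrib]
  | succ k ih =>
    obtain ⟨hpos, hq⟩ := ih s (fun l hl => hx l (by omega)) (fun l hl => hy l (by omega))
    have hx1 := hx (k + 1) le_rfl
    have hy1 := hy (k + 1) le_rfl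
    have hxy1 : 0 < esymmOn (k + 1) s (x + y) := by
      have h1 := div_pos hx1 (hx k (by omega))
      have h2 := div_pos hy1 (hy k (by omega))
      exact (div_pos_iff_of_pos_right (hpos k le_rfl)).1 (by linarith)
    refine ⟨fun l hl => ?_, ?_⟩
    · rcases Nat.le_succ_iff.1 hl with h | rfl
      · exact hpos l h
      · exact hxy1
    have hterm : ∀ i ∈ s,
        x i * esymmOn (k + 1) (s.erase i) x / esymmOn (k + 1) s x +
          y i * esymmOn (k + 1) (s.erase i) y / esymmOn (k + 1) s y ≤
        (x + y) i * esymmOn (k + 1) (s.erase i) (x + y) / esymmOn (k + 1) s (x + y) := by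
      intro i hi
      have hxi := erase_pos hx hi
      have hyi := erase_pos hy hi
      obtain ⟨hposi, hqi⟩ := ih (s.erase i) hxi hyi
      have hden : ∀ z : ι → ℝ, 0 < esymmOn (k + 1) s z → 0 < esymmOn k (s.erase i) z →
          0 < z i + esymmOn (k + 1) (s.erase i) z / esymmOn k (s.erase i) z := by
        intro z hz hzi
        rw [succ_eq_erase k hi] at hz
        have h := div_pos hz hzi
        rwa [add_div, mul_div_cancel_right₀ _ hzi.ne', add_comm] at h
      rw [mul_erase_div hx1 hi (hxi k le_rfl), mul_erase_div hy1 hi (hyi k le_rfl),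
        mul_erase_div hxy1 hi (hposi k le_rfl), Pi.add_apply]
      have h := add_sq_div_le (a := x i) (b := y i) (hden x hx1 (hxi k le_rfl))
        (hden y hy1 (hyi k le_rfl))
        (w := x i + y i +
          esymmOn (k + 1) (s.erase i) (x + y) / esymmOn k (s.erase i) (x + y)) (by linarith)
      linarith
    have hsum := Finset.sum_le_sum hterm
    rw [Finset.sum_add_distrib, ← Finset.sum_div, ← Finset.sum_div, ← Finset.sum_div,
      sum_mul_erase, sum_mul_erase, sum_mul_erase, mul_div_assoc, mul_div_assoc, mul_div_assoc,
      ← mul_add] at hsum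
    exact le_of_mul_le_mul_left hsum (by positivity)

/-- Adding a positive constant to every variable moves the closed cone into the open one. -/
theorem add_const_pos {k : ℕ} {s : Finset ι} (hk : k ≤ s.card) {x : ι → ℝ}
    (hx : ∀ l ≤ k, 0 ≤ esymmOn l s x) :
    ∀ l ≤ k, ∀ t : ℝ, 0 < t → 0 < esymmOn l s (fun i => x i + t) := by
  intro l
  induction l with
  | zero => simp
  | succ l ih =>
    intro hl t ht
    have hmono : StrictMonoOn (fun t : ℝ => esymmOn (l + 1) s (fun i => x i + t))
        (Set.Ici 0) := by
      refine strictMonoOn_of_deriv_pos (convex_Ici 0)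
        (fun u _ => (hasDerivAt_add_const l s x u).continuousAt.continuousWithinAt) ?_
      intro u hu
      rw [interior_Ici, Set.mem_Ioi] at hu
      rw [(hasDerivAt_add_const l s x u).deriv]
      have hc : (l : ℝ) < s.card := by exact_mod_cast (by omega : l < s.card)
      exact mul_pos (sub_pos.2 hc) (ih (by omega) u hu)
    have h := hmono Set.self_mem_Ici ht.le ht
    simp only [add_zero] at h
    exact (hx (l + 1) hl).trans_lt h

/-- The closed Gårding cone is closed under addition. -/
theorem add_nonneg {k : ℕ} {s : Finset ι} (hk : k ≤ s.card) {x y : ι → ℝ}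
    (hx : ∀ l ≤ k, 0 ≤ esymmOn l s x) (hy : ∀ l ≤ k, 0 ≤ esymmOn l s y) :
    ∀ l ≤ k, 0 ≤ esymmOn l s (x + y) := by
  intro l hl
  have hcont : Continuous fun t : ℝ =>
      esymmOn l s ((fun i => x i + t) + fun i => y i + t) :=
    (continuous l s).comp (by fun_prop)
  have hlim := (hcont.tendsto 0).mono_left (nhdsWithin_le_nhds (s := Set.Ioi 0))
  simp only [add_zero] at hlim
  refine ge_of_tendsto hlim ?_
  filter_upwards [self_mem_nhdsWithin] with t ht
  exact ((add_pos_and_superadditive k s _ _ (fun m hm => add_const_pos hk hx m hm t ht)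
    (fun m hm => add_const_pos hk hy m hm t ht)).1 l hl).le

end esymmOn

theorem mem_Lambda_iff {k N : ℕ} {x : Fin N → ℝ} :
    x ∈ Lambda k N ↔ ∀ l ≤ k, 0 ≤ esymmOn l Finset.univ x := by
  refine ⟨fun h l hl => ?_, fun h l _ hl => h l hl⟩
  rcases Nat.eq_zero_or_pos l with rfl | hpos
  · simp
  · exact h l hpos hl

/-- Proposition 3.6(2): `Λ_{k,N}` is a closed convex cone. -/
theorem Lambda_isClosedConvexCone (k N : ℕ) (hk : 1 ≤ k) (hkN : k ≤ N) :
    IsClosed (Lambda k N) ∧ Convex ℝ (Lambda k N) ∧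
      ∀ x ∈ Lambda k N, ∀ t : ℝ, 0 ≤ t → t • x ∈ Lambda k N := by
  have hsmul : ∀ x ∈ Lambda k N, ∀ t : ℝ, 0 ≤ t → t • x ∈ Lambda k N := by
    intro x hx t ht
    rw [mem_Lambda_iff] at hx ⊢
    intro l hl
    rw [esymmOn.smul]
    exact mul_nonneg (pow_nonneg ht l) (hx l hl)
  refine ⟨?_, ?_, hsmul⟩
  · have h : Lambda k N = ⋂ l ≤ k, {x | 0 ≤ esymmOn l Finset.univ x} := by
      ext x
      simp [mem_Lambda_iff]
    rw [h]
    exact isClosed_biInter fun l _ => isClosed_le continuous_const (esymmOn.continuous l _)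
  · intro x hx y hy a b ha hb _
    have hax := hsmul x hx a ha
    have hby := hsmul y hy b hb
    rw [mem_Lambda_iff] at hax hby ⊢
    exact esymmOn.add_nonneg (by simpa using hkN) hax hby
end
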